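/- Fix integers l, a ≥ 1 and a permutation σ₀ ∈ S_{la} whose cycle type consists of exactly a cycles of length l (so that the centralizer of σ₀ in S_{la} is isomorphic to the wreath product C_l^a ⋊ S_a). Let (λ_j)_{j=1}^m be the cycle lengths of a uniformly random permutation of S_a, let U_1,…,U_m be independent and uniform on {1,…,l}, independent of (λ_j), and set d_j = gcd(l, U_j) and k_j = l/d_j. Then the multiset consisting of the value λ_j·k_j with multiplicity d_j, for j = 1,…,m, is equal in distribution to the multiset of cycle lengths of a uniformly random element of the centralizer C_{S_{la}}(σ₀). Equivalently, if (b_i)_{i=1}^{la} is the cycle type of a uniform element of C_{S_{la}}(σ₀), then (b_i)_i is equal in distribution to (Σ_{j=1}^m d_j·1[λ_j k_j = i])_i. -/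

import Mathlib

/-- The cycle of the permutation `h` containing `x`, identified with its support set
(fixed points count as 1-cycles).  Since every cycle has length at most `n`, the orbit
of `x` under the powers of `h` is `{h^m x : m < n}`. -/
def permOrbit {n : ℕ} (h : Equiv.Perm (Fin n)) (x : Fin n) : Finset (Fin n) :=
  (Finset.range n).image (fun m => (h ^ m) x)

/-- The set of cycles of a permutation, each identified with its support set. -/
def permCycles {n : ℕ} (h : Equiv.Perm (Fin n)) : Finset (Finset (Fin n)) :=
  Finset.univ.image (permOrbit h)

/-- `cycCount h l` is the number of `l`-cycles of `h`; the function `l ↦ cycCount h l`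
is the cycle type of `h`. -/
def cycCount {n : ℕ} (h : Equiv.Perm (Fin n)) (l : ℕ) : ℕ :=
  ((permCycles h).filter (fun C => C.card = l)).card

/-- The cycle type produced by the construction of the proposition: sample a permutation
`π ∈ S_a` with cycle lengths `(λ_j)` and independent uniforms `U_j ∈ {1,…,l}` (one for
each cycle, realized here as `u x` at the minimal point `x` of each cycle, shifted to
`{1,…,l}`); with `d_j = gcd(l, U_j)` and `k_j = l/d_j`, each cycle of length `λ_j`
contributes the value `λ_j·k_j` with multiplicity `d_j`. -/
def wreathCycleType {l a : ℕ} (π : Equiv.Perm (Fin a)) (u : Fin a → Fin l) (i : ℕ) : ℕ :=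
  ∑ x : Fin a,
    if (∀ y ∈ permOrbit π x, x ≤ y) ∧
        (permOrbit π x).card * (l / Nat.gcd l ((u x : ℕ) + 1)) = i then
      Nat.gcd l ((u x : ℕ) + 1)
    else 0

open Finset Function in
theorem permOrbit_eq_image {n : ℕ} (h : Equiv.Perm (Fin n)) (x : Fin n) :
    permOrbit h x = (range (minimalPeriod h x)).image (fun m => (h ^ m) x) := by
  have hle : minimalPeriod h x ≤ n := by
    simpa using minimalPeriod_le_card (f := h) (x := x)
  apply Subset.antisymm
  · intro y hy
    obtain ⟨m, -, rfl⟩ := mem_image.1 hy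
    refine mem_image.2 ⟨m % minimalPeriod h x, mem_range.2 (Nat.mod_lt _ ?_), ?_⟩
    · exact minimalPeriod_pos_of_mem_periodicPts (h.injective.mem_periodicPts x)
    · simp only [Equiv.Perm.coe_pow, iterate_mod_minimalPeriod_eq]
  · exact image_subset_image (range_subset_range.2 hle)

open Function in
theorem pow_apply_injOn_minimalPeriod {n : ℕ} (h : Equiv.Perm (Fin n)) (x : Fin n) :
    Set.InjOn (fun m => (h ^ m) x) (Finset.range (minimalPeriod h x)) := by
  intro i hi j hj hij
  simp only [Finset.coe_range, Set.mem_Iio, Equiv.Perm.coe_pow] at hi hj hij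
  exact iterate_injOn_Iio_minimalPeriod hi hj hij

theorem card_permOrbit {n : ℕ} (h : Equiv.Perm (Fin n)) (x : Fin n) :
    (permOrbit h x).card = Function.minimalPeriod h x := by
  rw [permOrbit_eq_image, Finset.card_image_of_injOn (pow_apply_injOn_minimalPeriod h x),
    Finset.card_range]

theorem mem_permOrbit {n : ℕ} {h : Equiv.Perm (Fin n)} {x y : Fin n} :
    y ∈ permOrbit h x ↔ h.SameCycle x y := by
  constructor
  · intro hy
    obtain ⟨m, -, rfl⟩ := Finset.mem_image.1 hy
    exact ⟨m, by simp⟩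
  · intro hy
    obtain ⟨m, rfl⟩ := hy.exists_nat_pow_eq
    rw [permOrbit_eq_image]
    refine Finset.mem_image.2 ⟨m % Function.minimalPeriod h x,
      Finset.mem_range.2 (Nat.mod_lt _ ?_), ?_⟩
    · exact Function.minimalPeriod_pos_of_mem_periodicPts (h.injective.mem_periodicPts x)
    · simp only [Equiv.Perm.coe_pow, Function.iterate_mod_minimalPeriod_eq]

theorem self_mem_permOrbit {n : ℕ} (h : Equiv.Perm (Fin n)) (x : Fin n) :
    x ∈ permOrbit h x :=
  mem_permOrbit.2 (Equiv.Perm.SameCycle.refl h x)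

theorem permOrbit_eq_of_mem {n : ℕ} {h : Equiv.Perm (Fin n)} {x y : Fin n}
    (hy : y ∈ permOrbit h x) : permOrbit h y = permOrbit h x := by
  ext z
  rw [mem_permOrbit] at *
  rw [mem_permOrbit]
  exact ⟨hy.trans, hy.symm.trans⟩

theorem cycCount_mul {n : ℕ} (h : Equiv.Perm (Fin n)) (i : ℕ) :
    cycCount h i * i = (Finset.univ.filter fun x => (permOrbit h x).card = i).card := by
  rw [Finset.card_eq_sum_card_fiberwise (f := permOrbit h)
    (t := (permCycles h).filter fun C => C.card = i)]
  · rw [cycCount, ← smul_eq_mul, ← Finset.sum_const]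
    refine Finset.sum_congr rfl fun C hC => ?_
    obtain ⟨hC, hi⟩ := Finset.mem_filter.1 hC
    obtain ⟨x, -, rfl⟩ := Finset.mem_image.1 hC
    rw [← hi]
    congr 1
    ext y
    simp only [Finset.mem_filter, Finset.mem_univ, true_and]
    constructor
    · intro hy
      rw [permOrbit_eq_of_mem hy]
      exact ⟨rfl, rfl⟩
    · rintro ⟨-, hy⟩
      exact hy ▸ self_mem_permOrbit h y
  · intro x hx
    simpa [permCycles] using hx

/-- The least point of the cycle of `x`. -/
def permOrbitMin {n : ℕ} (h : Equiv.Perm (Fin n)) (x : Fin n) : Fin n :=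
  (permOrbit h x).min' ⟨x, self_mem_permOrbit h x⟩

theorem permOrbitMin_mem {n : ℕ} (h : Equiv.Perm (Fin n)) (x : Fin n) :
    permOrbitMin h x ∈ permOrbit h x :=
  Finset.min'_mem _ _

theorem permOrbitMin_eq_of_mem {n : ℕ} {h : Equiv.Perm (Fin n)} {x y : Fin n}
    (hy : y ∈ permOrbit h x) : permOrbitMin h y = permOrbitMin h x := by
  simp only [permOrbitMin, permOrbit_eq_of_mem hy]

theorem permOrbitMin_eq_self_iff {n : ℕ} {h : Equiv.Perm (Fin n)} {x : Fin n} :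
    permOrbitMin h x = x ↔ ∀ y ∈ permOrbit h x, x ≤ y := by
  constructor
  · intro hx y hy
    rw [← hx]
    exact Finset.min'_le _ _ hy
  · intro hx
    exact le_antisymm (Finset.min'_le _ _ (self_mem_permOrbit h x)) (hx _ (permOrbitMin_mem h x))

theorem card_filter_permOrbitMin {n : ℕ} (h : Equiv.Perm (Fin n)) (P : Fin n → Prop)
    [DecidablePred P] :
    (Finset.univ.filter fun x => P (permOrbitMin h x)).card =
      ∑ z with permOrbitMin h z = z ∧ P z, (permOrbit h z).card := by
  rw [Finset.card_eq_sum_card_fiberwise (f := permOrbitMin h)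
    (t := Finset.univ.filter fun z => permOrbitMin h z = z ∧ P z)]
  · refine Finset.sum_congr rfl fun z hz => ?_
    obtain ⟨hz, hP⟩ := (Finset.mem_filter.1 hz).2
    congr 1
    ext y
    simp only [Finset.mem_filter, Finset.mem_univ, true_and]
    constructor
    · rintro ⟨-, rfl⟩
      rw [permOrbit_eq_of_mem (permOrbitMin_mem h y)]
      exact self_mem_permOrbit h y
    · intro hy
      rw [permOrbitMin_eq_of_mem hy, hz]
      exact ⟨hP, rfl⟩
  · intro x hx
    have hx : P (permOrbitMin h x) := by simpa using hx
    simpa using ⟨permOrbitMin_eq_of_mem (permOrbitMin_mem h x), hx⟩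

theorem wreathCycleType_mul {l a : ℕ} (π : Equiv.Perm (Fin a)) (u : Fin a → Fin l) (i : ℕ) :
    wreathCycleType π u i * i = (Finset.univ.filter fun x : Fin a =>
      (permOrbit π x).card * (l / Nat.gcd l ((u (permOrbitMin π x) : ℕ) + 1)) = i).card * l := by
  have hmin : (Finset.univ.filter fun x : Fin a =>
      (permOrbit π x).card * (l / Nat.gcd l ((u (permOrbitMin π x) : ℕ) + 1)) = i) =
      Finset.univ.filter fun x => (permOrbit π (permOrbitMin π x)).card *
        (l / Nat.gcd l ((u (permOrbitMin π x) : ℕ) + 1)) = i :=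
    Finset.filter_congr fun x _ => by rw [permOrbit_eq_of_mem (permOrbitMin_mem π x)]
  rw [hmin, card_filter_permOrbitMin π fun z =>
    (permOrbit π z).card * (l / Nat.gcd l ((u z : ℕ) + 1)) = i, wreathCycleType,
    Finset.sum_filter, Finset.sum_mul, Finset.sum_mul]
  refine Finset.sum_congr rfl fun x _ => ?_
  simp only [permOrbitMin_eq_self_iff]
  split_ifs with h
  · rw [← h.2, mul_left_comm, Nat.mul_div_cancel' (Nat.gcd_dvd_left _ _)]
  · simp

open Function in
theorem iterate_prodShear_addRight {α A : Type*} [AddCommGroup A] (π : Equiv.Perm α) (w : α → A)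
    (n : ℕ) (p : α × A) :
    (π.prodShear fun x => Equiv.addRight (w x))^[n] p =
      (π^[n] p.1, p.2 + ∑ m ∈ Finset.range n, w (π^[m] p.1)) := by
  induction n with
  | zero => simp
  | succ n ih =>
    rw [iterate_succ_apply', ih, Finset.sum_range_succ, iterate_succ_apply']
    simp [add_assoc]

open Function in
theorem minimalPeriod_prodShear_addRight {α A : Type*} [AddCommGroup A] (π : Equiv.Perm α)
    (w : α → A) (p : α × A) :
    minimalPeriod (π.prodShear fun x => Equiv.addRight (w x)) p =
      minimalPeriod π p.1 *
        addOrderOf (∑ m ∈ Finset.range (minimalPeriod π p.1), w (π^[m] p.1)) := by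
  set L := minimalPeriod π p.1 with hL
  set S := ∑ m ∈ Finset.range L, w (π^[m] p.1) with hS
  have hsum : ∀ k : ℕ, ∑ m ∈ Finset.range (L * k), w (π^[m] p.1) = k • S := by
    intro k
    induction k with
    | zero => simp
    | succ k ih =>
      rw [Nat.mul_succ, Finset.sum_range_add, ih, succ_nsmul, hS]
      congr 1
      refine Finset.sum_congr rfl fun m _ => ?_
      rw [add_comm, iterate_add_apply, ((isPeriodicPt_minimalPeriod π p.1).mul_const k).eq]
  refine (Nat.dvd_right_iff_eq.1 fun n => ?_).symm
  rw [← isPeriodicPt_iff_minimalPeriod_dvd, IsPeriodicPt, IsFixedPt, iterate_prodShear_addRight,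
    Prod.ext_iff]
  constructor
  · rintro ⟨k, rfl⟩
    rw [mul_assoc, hsum]
    simp [mul_smul, (isPeriodicPt_minimalPeriod π p.1).mul_const _ |>.eq, hL,
      mul_comm (addOrderOf _), addOrderOf_nsmul_eq_zero]
  · rintro ⟨h1, h2⟩
    obtain ⟨k, rfl⟩ : L ∣ n := (isPeriodicPt_iff_minimalPeriod_dvd).1 h1
    rw [hsum] at h2
    exact mul_dvd_mul_left _ (addOrderOf_dvd_of_nsmul_eq_zero (by simpa using h2))

open Function in
theorem exists_equiv_prod_zmod {α : Type*} [Fintype α] {l a : ℕ} [NeZero l] (σ : Equiv.Perm α)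
    (hσ : ∀ x, minimalPeriod σ x = l) (hα : Fintype.card α = l * a) :
    ∃ e : Fin a × ZMod l ≃ α, ∀ x c, σ (e (x, c)) = e (x, c + 1) := by
  classical
  let f : Quotient (Equiv.Perm.SameCycle.setoid σ) × ZMod l → α := fun q => σ^[q.2.val] q.1.out
  have hf : ∀ q (n : ℕ), f (q, (n : ZMod l)) = σ^[n] q.out := fun q n => by
    simp only [f, ZMod.val_natCast]
    rw [← hσ q.out, iterate_mod_minimalPeriod_eq]
  have hq : ∀ q n, (⟦σ^[n] q.out⟧ : Quotient (Equiv.Perm.SameCycle.setoid σ)) = q := fun q n => by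
    conv_rhs => rw [← q.out_eq]
    refine Quotient.sound ?_
    exact Equiv.Perm.SameCycle.symm ⟨n, by rw [zpow_natCast, Equiv.Perm.coe_pow]⟩
  have hbij : Bijective f := by
    constructor
    · rintro ⟨q, c⟩ ⟨q', c'⟩ h
      have hqq : q = q' := by
        rw [← hq q c.val, ← hq q' c'.val]
        exact congrArg _ h
      subst hqq
      have := iterate_injOn_Iio_minimalPeriod (f := σ) (x := q.out)
        (by simpa [hσ] using c.val_lt) (by simpa [hσ] using c'.val_lt) h
      exact Prod.ext rfl (ZMod.val_injective l this)
    · intro y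
      have hy : σ.SameCycle (⟦y⟧ : Quotient (Equiv.Perm.SameCycle.setoid σ)).out y :=
        Quotient.exact (s := Equiv.Perm.SameCycle.setoid σ) (Quotient.out_eq _)
      obtain ⟨n, hn⟩ := hy.exists_nat_pow_eq
      exact ⟨(_, (n : ZMod l)), by rw [hf, ← Equiv.Perm.coe_pow, hn]⟩
  have hcard : Fintype.card (Quotient (Equiv.Perm.SameCycle.setoid σ)) = a := by
    have := Fintype.card_of_bijective hbij
    rw [Fintype.card_prod, ZMod.card, hα, mul_comm] at this
    exact Nat.eq_of_mul_eq_mul_left (NeZero.pos l) this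
  refine ⟨((Fintype.equivFinOfCardEq hcard).symm.prodCongr (Equiv.refl _)).trans
    (Equiv.ofBijective f hbij), fun x c => ?_⟩
  obtain ⟨n, rfl⟩ := ZMod.natCast_zmod_surjective c
  have hn : (n : ZMod l) + 1 = ((n + 1 : ℕ) : ZMod l) := by push_cast; rfl
  simp only [Equiv.trans_apply, Equiv.prodCongr_apply, Prod.map, Equiv.refl_apply,
    Equiv.ofBijective_apply]
  rw [hn, hf, hf, iterate_succ_apply']

/-- Replaces the value at the least point of each cycle so that the sum over the cycle becomes the
old value at that point. -/
def cycleSumShear {a : ℕ} {A : Type*} [AddCommGroup A] (π : Equiv.Perm (Fin a)) (u : Fin a → A)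
    (x : Fin a) : A :=
  if permOrbitMin π x = x then u x - ∑ y ∈ (permOrbit π x).erase x, u y else u x

theorem cycleSumShear_of_mem_erase {a : ℕ} {A : Type*} [AddCommGroup A] {π : Equiv.Perm (Fin a)}
    (u : Fin a → A) {x y : Fin a} (hx : permOrbitMin π x = x) (hy : y ∈ (permOrbit π x).erase x) :
    cycleSumShear π u y = u y := by
  obtain ⟨hne, hy⟩ := Finset.mem_erase.1 hy
  rw [cycleSumShear, if_neg]
  rw [permOrbitMin_eq_of_mem hy, hx]
  exact hne.symm

theorem sum_cycleSumShear {a : ℕ} {A : Type*} [AddCommGroup A] (π : Equiv.Perm (Fin a))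
    (u : Fin a → A) (x : Fin a) :
    ∑ y ∈ permOrbit π x, cycleSumShear π u y = u (permOrbitMin π x) := by
  have hz := permOrbitMin_eq_of_mem (permOrbitMin_mem π x)
  rw [← permOrbit_eq_of_mem (permOrbitMin_mem π x)]
  generalize permOrbitMin π x = z at hz
  rw [← Finset.add_sum_erase _ _ (self_mem_permOrbit π z),
    Finset.sum_congr rfl fun y hy => cycleSumShear_of_mem_erase u hz hy, cycleSumShear, if_pos hz,
    sub_add_cancel]

theorem cycleSumShear_injective {a : ℕ} {A : Type*} [AddCommGroup A] (π : Equiv.Perm (Fin a)) :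
    Function.Injective (cycleSumShear (A := A) π) := by
  intro u v h
  funext x
  by_cases hx : permOrbitMin π x = x
  · have := sum_cycleSumShear π u x
    rw [h, sum_cycleSumShear, hx] at this
    exact this.symm
  · simpa [cycleSumShear, hx] using congrFun h x

theorem sum_permOrbit {n : ℕ} {A : Type*} [AddCommMonoid A] (h : Equiv.Perm (Fin n))
    (w : Fin n → A) (x : Fin n) :
    ∑ y ∈ permOrbit h x, w y = ∑ m ∈ Finset.range (Function.minimalPeriod h x), w (h^[m] x) := by
  rw [permOrbit_eq_image, Finset.sum_image (pow_apply_injOn_minimalPeriod h x)]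
  simp only [Equiv.Perm.coe_pow]

theorem exists_eq_prodShear_addRight {α : Type*} [Finite α] {l : ℕ} [NeZero l]
    (τ : Equiv.Perm (α × ZMod l)) (hτ : ∀ x c, τ (x, c + 1) = ((τ (x, c)).1, (τ (x, c)).2 + 1)) :
    ∃ (π : Equiv.Perm α) (w : α → ZMod l), τ = π.prodShear fun x => Equiv.addRight (w x) := by
  have h : ∀ x c, τ (x, c) = ((τ (x, 0)).1, c + (τ (x, 0)).2) := by
    intro x c
    obtain ⟨n, rfl⟩ := ZMod.natCast_zmod_surjective c
    induction n with
    | zero => simp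
    | succ n ih =>
      push_cast
      rw [hτ, ih]
      ext
      · rfl
      · simp only
        ring
  have hinj : Function.Injective fun x => (τ (x, 0)).1 := by
    intro x y hxy
    have : τ (x, (τ (y, 0)).2 - (τ (x, 0)).2) = τ (y, 0) := by
      rw [h x, sub_add_cancel]
      exact Prod.ext hxy rfl
    exact congrArg Prod.fst (τ.injective this)
  refine ⟨Equiv.ofBijective _ (Finite.injective_iff_bijective.1 hinj), fun x => (τ (x, 0)).2, ?_⟩
  ext1 ⟨x, c⟩
  exact h x c

/-- The permutation of `Fin (l * a)` which, in the coordinates `e`, acts on the first factor by `π`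
and translates the second so that the total translation along each cycle of `π` is `u + 1` at the
least point of the cycle. -/
def wreathPerm {l a : ℕ} (e : Fin a × ZMod l ≃ Fin (l * a)) (π : Equiv.Perm (Fin a))
    (u : Fin a → Fin l) : Equiv.Perm (Fin (l * a)) :=
  e.permCongr (π.prodShear fun x =>
    Equiv.addRight (cycleSumShear π (fun y => (((u y : ℕ) + 1 : ℕ) : ZMod l)) x))

theorem wreathPerm_apply {l a : ℕ} (e : Fin a × ZMod l ≃ Fin (l * a)) (π : Equiv.Perm (Fin a))
    (u : Fin a → Fin l) (x : Fin a) (c : ZMod l) :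
    wreathPerm e π u (e (x, c)) =
      e (π x, c + cycleSumShear π (fun y => (((u y : ℕ) + 1 : ℕ) : ZMod l)) x) := by
  simp [wreathPerm, Equiv.permCongr_apply]

open Function in
theorem minimalPeriod_eq_of_semiconj {α β : Type*} {f : α → α} {g : β → β} {e : α → β}
    (h : Semiconj e f g) (he : Injective e) (x : α) :
    minimalPeriod g (e x) = minimalPeriod f x := by
  refine (Nat.dvd_right_iff_eq.1 fun n => ?_)
  rw [← isPeriodicPt_iff_minimalPeriod_dvd, ← isPeriodicPt_iff_minimalPeriod_dvd, IsPeriodicPt,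
    IsFixedPt, ← (h.iterate_right n).eq, he.eq_iff, IsPeriodicPt, IsFixedPt]

theorem card_permOrbit_wreathPerm {l a : ℕ} (hl : 0 < l) (e : Fin a × ZMod l ≃ Fin (l * a))
    (π : Equiv.Perm (Fin a)) (u : Fin a → Fin l) (p : Fin a × ZMod l) :
    (permOrbit (wreathPerm e π u) (e p)).card =
      (permOrbit π p.1).card * (l / Nat.gcd l ((u (permOrbitMin π p.1) : ℕ) + 1)) := by
  have hsemi : Function.Semiconj e (π.prodShear fun x =>
      Equiv.addRight (cycleSumShear π (fun y => (((u y : ℕ) + 1 : ℕ) : ZMod l)) x))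
      (wreathPerm e π u) := fun q => by simp [wreathPerm, Equiv.permCongr_apply]
  rw [card_permOrbit, card_permOrbit, minimalPeriod_eq_of_semiconj hsemi e.injective,
    minimalPeriod_prodShear_addRight, ← sum_permOrbit π _ p.1, sum_cycleSumShear,
    ZMod.addOrderOf_coe _ hl.ne']

theorem cycCount_wreathPerm {l a : ℕ} (hl : 0 < l) (e : Fin a × ZMod l ≃ Fin (l * a))
    (π : Equiv.Perm (Fin a)) (u : Fin a → Fin l) (i : ℕ) :
    cycCount (wreathPerm e π u) i = wreathCycleType π u i := by
  have : NeZero l := ⟨hl.ne'⟩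
  rcases Nat.eq_zero_or_pos i with rfl | hi
  · rw [wreathCycleType, Finset.sum_eq_zero, cycCount, Finset.card_eq_zero,
      Finset.filter_eq_empty_iff]
    · intro C hC
      obtain ⟨x, -, rfl⟩ := Finset.mem_image.1 hC
      exact Finset.card_ne_zero_of_mem (self_mem_permOrbit _ x)
    · intro x _
      refine if_neg fun h => ?_
      refine mul_ne_zero (Finset.card_ne_zero_of_mem (self_mem_permOrbit π x)) ?_ h.2
      exact (Nat.div_pos (Nat.gcd_le_left _ hl) (Nat.gcd_pos_of_pos_left _ hl)).ne'
  · apply Nat.eq_of_mul_eq_mul_right hi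
    rw [cycCount_mul, wreathCycleType_mul]
    have hcard : l = (Finset.univ : Finset (ZMod l)).card := by rw [Finset.card_univ, ZMod.card]
    refine Eq.trans ?_ (congrArg _ hcard.symm)
    rw [← Finset.card_product]
    refine (Finset.card_equiv e fun p => ?_).symm
    simp [card_permOrbit_wreathPerm hl]

theorem natCast_val_add_one_injective (l : ℕ) :
    Function.Injective fun i : Fin l => (((i : ℕ) + 1 : ℕ) : ZMod l) := by
  intro i j h
  have := Nat.ModEq.add_right_cancel' 1 ((ZMod.natCast_eq_natCast_iff _ _ _).1 h)
  exact Fin.ext (Nat.ModEq.eq_of_lt_of_lt this i.isLt j.isLt)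

theorem wreathPerm_injective {l a : ℕ} (e : Fin a × ZMod l ≃ Fin (l * a)) :
    Function.Injective fun p : Equiv.Perm (Fin a) × (Fin a → Fin l) => wreathPerm e p.1 p.2 := by
  rintro ⟨π, u⟩ ⟨π', u'⟩ h
  have h' : ∀ x, (π x, cycleSumShear π (fun y => (((u y : ℕ) + 1 : ℕ) : ZMod l)) x) =
      (π' x, cycleSumShear π' (fun y => (((u' y : ℕ) + 1 : ℕ) : ZMod l)) x) := fun x => by
    have := Equiv.congr_fun h (e (x, 0))
    simpa only [wreathPerm_apply, zero_add, e.apply_eq_iff_eq] using this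
  obtain rfl : π = π' := Equiv.ext fun x => congrArg Prod.fst (h' x)
  have hu := cycleSumShear_injective π (funext fun x => congrArg Prod.snd (h' x))
  exact Prod.ext rfl (funext fun x => natCast_val_add_one_injective l (congrFun hu x))

theorem commute_iff_exists_wreathPerm {l a : ℕ} (hl : 0 < l) {σ : Equiv.Perm (Fin (l * a))}
    {e : Fin a × ZMod l ≃ Fin (l * a)} (he : ∀ x c, σ (e (x, c)) = e (x, c + 1))
    (τ : Equiv.Perm (Fin (l * a))) :
    Commute σ τ ↔ ∃ p : Equiv.Perm (Fin a) × (Fin a → Fin l), wreathPerm e p.1 p.2 = τ := by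
  have : NeZero l := ⟨hl.ne'⟩
  constructor
  · intro h
    obtain ⟨π, w, hw⟩ := exists_eq_prodShear_addRight (e.symm.permCongr τ) fun x c => by
      have h1 : τ (e (x, c + 1)) = σ (τ (e (x, c))) := by
        rw [← he]
        exact (Equiv.congr_fun h.eq _).symm
      simp only [Equiv.permCongr_apply, Equiv.symm_symm, h1]
      rw [Equiv.symm_apply_eq, ← he, Prod.mk.eta, e.apply_symm_apply]
    have hsurj : Function.Bijective fun u : Fin a → Fin l =>
        cycleSumShear π (fun y => (((u y : ℕ) + 1 : ℕ) : ZMod l)) := by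
      rw [Fintype.bijective_iff_injective_and_card]
      refine ⟨fun u v huv => ?_, by simp⟩
      have := cycleSumShear_injective π huv
      exact funext fun x => natCast_val_add_one_injective l (congrFun this x)
    obtain ⟨u, rfl⟩ := hsurj.2 w
    refine ⟨(π, u), ?_⟩
    rw [wreathPerm, ← hw]
    ext
    simp [Equiv.permCongr_apply]
  · rintro ⟨⟨π, u⟩, rfl⟩
    refine Equiv.ext fun y => ?_
    obtain ⟨⟨x, c⟩, rfl⟩ := e.surjective y
    simp only [Equiv.Perm.mul_apply, he, wreathPerm_apply, add_right_comm]

theorem card_commute_and {l a : ℕ} (hl : 0 < l) {σ : Equiv.Perm (Fin (l * a))}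
    {e : Fin a × ZMod l ≃ Fin (l * a)} (he : ∀ x c, σ (e (x, c)) = e (x, c + 1))
    (P : Equiv.Perm (Fin (l * a)) → Prop) :
    Nat.card {τ : Equiv.Perm (Fin (l * a)) // Commute σ τ ∧ P τ} =
      Nat.card {p : Equiv.Perm (Fin a) × (Fin a → Fin l) // P (wreathPerm e p.1 p.2)} := by
  symm
  refine Nat.card_congr (Equiv.ofBijective
    (fun p => ⟨wreathPerm e p.1.1 p.1.2, (commute_iff_exists_wreathPerm hl he _).2 ⟨p.1, rfl⟩, p.2⟩)
    ⟨fun p q h => ?_, fun τ => ?_⟩)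
  · exact Subtype.ext (wreathPerm_injective e (congrArg Subtype.val h))
  · obtain ⟨τ, hτ, hP⟩ := τ
    obtain ⟨p, rfl⟩ := (commute_iff_exists_wreathPerm hl he τ).1 hτ
    exact ⟨⟨p, hP⟩, rfl⟩

theorem card_commute {l a : ℕ} (hl : 0 < l) {σ : Equiv.Perm (Fin (l * a))}
    {e : Fin a × ZMod l ≃ Fin (l * a)} (he : ∀ x c, σ (e (x, c)) = e (x, c + 1)) :
    Nat.card {τ : Equiv.Perm (Fin (l * a)) // Commute σ τ} = Nat.factorial a * l ^ a := by
  have h := card_commute_and hl he fun _ => True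
  simp only [and_true] at h
  rw [h, Nat.card_congr (Equiv.subtypeUnivEquiv fun _ => trivial), Nat.card_prod, Nat.card_perm,
    Nat.card_fun, Nat.card_fin, Nat.card_fin]

/-- Fix `l, a ≥ 1` and `σ₀ ∈ S_{la}` all of whose cycles have length `l` (so `σ₀` has
exactly `a` cycles of length `l`, and its centralizer is isomorphic to the wreath
product `C_l^a ⋊ S_a`).  Then the cycle type `(b_i)` of a uniformly random element of
the centralizer `C_{S_{la}}(σ₀)` is equal in distribution to
`(Σ_j d_j·1[λ_j k_j = i])_i`, where `(λ_j)` are the cycle lengths of a uniformly random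
element of `S_a`, the `U_j` are independent uniforms on `{1,…,l}` (independent of the
`λ_j`), `d_j = gcd(l, U_j)` and `k_j = l/d_j`. -/
theorem centralizer_cycle_type_distribution (l a : ℕ) (hl : 0 < l) (ha : 0 < a)
    (σ₀ : Equiv.Perm (Fin (l * a)))
    (hcyc : ∀ x : Fin (l * a), (permOrbit σ₀ x).card = l) :
    ∀ v : ℕ → ℕ,
      (Nat.card {τ : Equiv.Perm (Fin (l * a)) //
          Commute σ₀ τ ∧ (fun i => cycCount τ i) = v} : ℚ)
        / (Nat.card {τ : Equiv.Perm (Fin (l * a)) // Commute σ₀ τ} : ℚ)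
      = (Nat.card {p : Equiv.Perm (Fin a) × (Fin a → Fin l) //
          (fun i => wreathCycleType p.1 p.2 i) = v} : ℚ)
          / ((Nat.factorial a * l ^ a : ℕ) : ℚ) := by
  intro v
  have : NeZero l := ⟨hl.ne'⟩
  obtain ⟨e, he⟩ := exists_equiv_prod_zmod σ₀ (fun x => (card_permOrbit σ₀ x).symm.trans (hcyc x))
    (Fintype.card_fin _)
  rw [card_commute hl he, card_commute_and hl he fun τ => (fun i => cycCount τ i) = v]
  simp only [cycCount_wreathPerm hl]
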